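/- (Even–Gillis, general k) For every k ≥ 1 and all natural numbers n₁, …, n_k, the multiset derangement number satisfies D(n₁, …, n_k) = (−1)^{n₁+⋯+n_k} ∫₀^∞ L_{n₁}(x) L_{n₂}(x) ⋯ L_{n_k}(x) e^{−x} dx. -/

import Mathlib

/-- The "address" map: position `j` of `Fin (n₁ + ⋯ + n_k)` is sent to the index `i`
of the consecutive block of size `n i` containing `j` (the first `n 0` positions get
address `0`, the next `n 1` positions get address `1`, etc.).  Formally, `addr n j`
is the least `i` such that `j < n 0 + ⋯ + n i`. -/
def addr {k : ℕ} (n : Fin k → ℕ) (j : Fin (∑ i, n i)) : Fin k :=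
  (Finset.univ.filter (fun i => (j : ℕ) < ∑ i' ∈ Finset.univ.filter (· ≤ i), n i')).min'
    (by
      match k with
      | 0 => exact absurd j.2 (by simp)
      | m + 1 =>
        refine ⟨Fin.last m, ?_⟩
        simp only [Finset.mem_filter, Finset.mem_univ, true_and]
        have h : Finset.univ.filter (· ≤ Fin.last m) = (Finset.univ : Finset (Fin (m + 1))) := by
          ext i; simp [Fin.le_last]
        rw [h]
        exact j.2)

/-- The multiset derangement number `D(n₁, …, n_k)`: the number of functions
`f : Fin (n₁ + ⋯ + n_k) → Fin k` such that each fiber `f⁻¹(i)` has exactly `n i`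
elements and `f j ≠ addr n j` for every position `j`. -/
def multiD (k : ℕ) (n : Fin k → ℕ) : ℕ :=
  Fintype.card {f : Fin (∑ i, n i) → Fin k //
    (∀ i, (Finset.univ.filter (fun j => f j = i)).card = n i) ∧ ∀ j, f j ≠ addr n j}


open Nat

/-- The `n`-th Laguerre polynomial, `L_n(x) = ∑_{k=0}^{n} (−1)^k (n choose k) x^k / k!`. -/
noncomputable def laguerre (n : ℕ) (x : ℝ) : ℝ :=
  ∑ k ∈ Finset.range (n + 1), (-1 : ℝ) ^ k * (n.choose k : ℝ) * x ^ k / (k ! : ℝ)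

lemma eg_addr_iff {k : ℕ} (n : Fin k → ℕ) (j : Fin (∑ i, n i)) (i : Fin k) :
    addr n j = i ↔ (∑ i' ∈ Finset.univ.filter (· < i), n i') ≤ (j : ℕ) ∧
      (j : ℕ) < ∑ i' ∈ Finset.univ.filter (· ≤ i), n i' := by
  have key : ∀ a b : Fin k, a < b → ∑ i' ∈ Finset.univ.filter (· ≤ a), n i' ≤
      ∑ i' ∈ Finset.univ.filter (· < b), n i' := by
    intro a b hab
    apply Finset.sum_le_sum_of_subset
    intro x hx
    simp only [Finset.mem_filter, Finset.mem_univ, true_and] at hx ⊢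
    exact lt_of_le_of_lt hx hab
  constructor
  · rintro rfl
    refine ⟨?_, ?_⟩
    · by_contra! h
      by_cases h0 : (addr n j : ℕ) = 0
      · have : Finset.univ.filter (· < addr n j) = ∅ := by
          ext x
          simp only [Finset.mem_filter, Finset.mem_univ, true_and, Finset.notMem_empty, iff_false,
            Fin.lt_def]
          omega
        rw [this] at h
        simp at h
      · let p : Fin k := ⟨(addr n j : ℕ) - 1, by have := (addr n j).2; omega⟩
        have hp : Finset.univ.filter (· < addr n j) = Finset.univ.filter (· ≤ p) := by
          ext x
          simp only [Finset.mem_filter, Finset.mem_univ, true_and, Fin.lt_def, Fin.le_def, p]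
          omega
        rw [hp] at h
        have : addr n j ≤ p := Finset.min'_le _ _ (by simpa using h)
        simp only [Fin.le_def, p] at this
        omega
    · have := Finset.min'_mem (Finset.univ.filter
        (fun i => (j : ℕ) < ∑ i' ∈ Finset.univ.filter (· ≤ i), n i')) ?_
      · exact (Finset.mem_filter.1 this).2
  · rintro ⟨h1, h2⟩
    apply le_antisymm
    · exact Finset.min'_le _ _ (by simpa using h2)
    · apply Finset.le_min'
      intro y hy
      by_contra! hlt
      have := key y i hlt
      have hy' := (Finset.mem_filter.1 hy).2
      omega

lemma eg_addr_card {k : ℕ} (n : Fin k → ℕ) (i : Fin k) :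
    (Finset.univ.filter (fun j => addr n j = i)).card = n i := by
  have hs : ∑ i' ∈ Finset.univ.filter (· ≤ i), n i' =
      n i + ∑ i' ∈ Finset.univ.filter (· < i), n i' := by
    rw [← Finset.sum_insert (by simp)]
    congr 1
    ext x
    simp [le_iff_eq_or_lt]
  have hle : ∑ i' ∈ Finset.univ.filter (· ≤ i), n i' ≤ ∑ i', n i' :=
    Finset.sum_le_sum_of_subset (Finset.filter_subset _ _)
  rw [← Finset.card_map Fin.valEmbedding]
  have : (Finset.univ.filter (fun j => addr n j = i)).map Fin.valEmbedding =
      Finset.Ico (∑ i' ∈ Finset.univ.filter (· < i), n i')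
        (∑ i' ∈ Finset.univ.filter (· ≤ i), n i') := by
    ext x
    simp only [Finset.mem_map, Finset.mem_filter, Finset.mem_univ, true_and, eg_addr_iff,
      Fin.valEmbedding_apply, Finset.mem_Ico]
    constructor
    · rintro ⟨a, h, rfl⟩
      exact h
    · intro h
      exact ⟨⟨x, by omega⟩, h, rfl⟩
  rw [this, Nat.card_Ico]
  omega

open MvPolynomial in
lemma eg_count (k : ℕ) (n : Fin k → ℕ) :
    (multiD k n : ℝ) = coeff (Finsupp.equivFunOnFinite.symm n)
      (∏ i : Fin k, ((∑ a, X a) - X i : MvPolynomial (Fin k) ℝ) ^ n i) := by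
  have h1 : (∏ i : Fin k, ((∑ a, X a) - X i : MvPolynomial (Fin k) ℝ) ^ n i) =
      ∏ j : Fin (∑ i, n i), ∑ a ∈ Finset.univ.erase (addr n j), X a := by
    rw [← Finset.prod_fiberwise' Finset.univ (addr n)
      (fun i => ∑ a ∈ Finset.univ.erase i, (X a : MvPolynomial (Fin k) ℝ))]
    refine Finset.prod_congr rfl fun i _ => ?_
    rw [Finset.prod_const, eg_addr_card, Finset.sum_erase_eq_sub (Finset.mem_univ i)]
  have h2 : ∀ f : Fin (∑ i, n i) → Fin k, (∏ j, X (f j) : MvPolynomial (Fin k) ℝ) =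
      monomial (Finsupp.equivFunOnFinite.symm
        fun i => (Finset.univ.filter (fun j => f j = i)).card) 1 := by
    intro f
    rw [← Finset.prod_fiberwise' Finset.univ f (fun i => (X i : MvPolynomial (Fin k) ℝ)),
      monomial_eq, Finsupp.prod_fintype _ _ (by simp)]
    simp
  rw [h1, Finset.prod_univ_sum, coeff_sum]
  simp only [h2, coeff_monomial]
  rw [Finset.sum_boole, multiD, Fintype.card_subtype]
  congr 2
  ext f
  simp only [Finset.mem_filter, Finset.mem_univ, true_and, Fintype.mem_piFinset,
    Finset.mem_erase, and_true, Equiv.apply_eq_iff_eq, funext_iff]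
  tauto

open MvPolynomial in
lemma eg_coeff_pow (k : ℕ) (m : Fin k → ℕ) :
    coeff (Finsupp.equivFunOnFinite.symm m)
      ((∑ a, X a : MvPolynomial (Fin k) ℝ) ^ (∑ i, m i)) =
      ((∑ i, m i)! : ℝ) / ∏ i, ((m i)! : ℝ) := by
  rw [Finset.sum_pow_eq_sum_piAntidiag, coeff_sum]
  have h2 : ∀ f : Fin k → ℕ, (∏ j, X j ^ f j : MvPolynomial (Fin k) ℝ) =
      monomial (Finsupp.equivFunOnFinite.symm f) 1 := by
    intro f
    rw [monomial_eq, Finsupp.prod_fintype _ _ (by simp)]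
    simp
  simp only [h2, ← C_eq_coe_nat, coeff_C_mul, coeff_monomial, Equiv.apply_eq_iff_eq]
  rw [Finset.sum_eq_single m]
  · simp only [if_true, mul_one]
    rw [eq_div_iff (Finset.prod_ne_zero_iff.2 fun i _ => by positivity), mul_comm]
    exact_mod_cast Nat.multinomial_spec Finset.univ m
  · intro b _ hb
    simp [hb]
  · intro h
    exact absurd (by simp) h

open MvPolynomial in
lemma eg_coeff (k : ℕ) (n : Fin k → ℕ) :
    coeff (Finsupp.equivFunOnFinite.symm n)
      (∏ i : Fin k, ((∑ a, X a) - X i : MvPolynomial (Fin k) ℝ) ^ n i) =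
    ∑ m ∈ Fintype.piFinset (fun i => Finset.range (n i + 1)),
      (∏ i, ((-1 : ℝ) ^ (n i - m i) * ((n i).choose (m i) : ℝ))) *
        (((∑ i, m i)! : ℝ) / ∏ i, ((m i)! : ℝ)) := by
  simp only [sub_eq_add_neg, add_pow]
  rw [Finset.prod_univ_sum, coeff_sum]
  refine Finset.sum_congr rfl fun m hm => ?_
  have hm' : ∀ i, m i ≤ n i := fun i => by
    have := Fintype.mem_piFinset.1 hm i
    simp at this
    omega
  have e : (∏ i, ((∑ a, X a : MvPolynomial (Fin k) ℝ) ^ m i * (-X i) ^ (n i - m i) *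
      ((n i).choose (m i) : MvPolynomial (Fin k) ℝ))) =
      monomial (Finsupp.equivFunOnFinite.symm fun i => n i - m i)
        (∏ i, ((-1 : ℝ) ^ (n i - m i) * ((n i).choose (m i) : ℝ))) *
        (∑ a, X a : MvPolynomial (Fin k) ℝ) ^ (∑ i, m i) := by
    rw [monomial_eq, Finsupp.prod_fintype _ _ (by simp), map_prod, ← Finset.prod_pow_eq_pow_sum,
      ← Finset.prod_mul_distrib, ← Finset.prod_mul_distrib]
    refine Finset.prod_congr rfl fun i _ => ?_
    rw [neg_pow]
    simp
    ring
  have hn : (Finsupp.equivFunOnFinite.symm n : Fin k →₀ ℕ) =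
      Finsupp.equivFunOnFinite.symm (fun i => n i - m i) + Finsupp.equivFunOnFinite.symm m := by
    ext i
    simp [hm' i]
  rw [e, hn, coeff_monomial_mul, eg_coeff_pow]

lemma eg_int (M : ℕ) : MeasureTheory.IntegrableOn (fun x : ℝ => x ^ M * Real.exp (-x)) (Set.Ioi 0) ∧
    ∫ x in Set.Ioi (0 : ℝ), x ^ M * Real.exp (-x) = (M ! : ℝ) := by
  have hM : (0 : ℝ) < M + 1 := by positivity
  constructor
  · have := Real.GammaIntegral_convergent hM
    simpa [mul_comm] using this
  · rw [← Real.Gamma_nat_eq_factorial, Real.Gamma_eq_integral hM]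
    simp [mul_comm]

theorem even_gillis (k : ℕ) (hk : 1 ≤ k) (n : Fin k → ℕ) :
    (multiD k n : ℝ) =
      (-1 : ℝ) ^ (∑ i, n i) *
        ∫ x in Set.Ioi (0 : ℝ), (∏ i, laguerre (n i) x) * Real.exp (-x) := by
  have h : ∀ x : ℝ, (∏ i, laguerre (n i) x) * Real.exp (-x) =
      ∑ m ∈ Fintype.piFinset (fun i => Finset.range (n i + 1)),
        (∏ i, ((-1 : ℝ) ^ m i * ((n i).choose (m i) : ℝ) / ((m i)! : ℝ))) *
          (x ^ (∑ i, m i) * Real.exp (-x)) := by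
    intro x
    simp only [laguerre]
    rw [Finset.prod_univ_sum, Finset.sum_mul]
    refine Finset.sum_congr rfl fun m _ => ?_
    rw [← mul_assoc, ← Finset.prod_pow_eq_pow_sum, ← Finset.prod_mul_distrib]
    congr 1
    refine Finset.prod_congr rfl fun i _ => ?_
    ring
  simp only [h]
  rw [MeasureTheory.integral_finsetSum _ (fun m _ => (eg_int _).1.const_mul _), eg_count, eg_coeff,
    Finset.mul_sum]
  refine Finset.sum_congr rfl fun m hm => ?_
  rw [MeasureTheory.integral_const_mul, (eg_int _).2, ← mul_assoc, mul_div_left_comm, mul_comm,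
    ← Finset.prod_div_distrib, ← Finset.prod_pow_eq_pow_sum, ← Finset.prod_mul_distrib]
  congr 1
  refine Finset.prod_congr rfl fun i _ => ?_
  have hmi : m i ≤ n i := by
    have := Fintype.mem_piFinset.1 hm i
    simp at this
    omega
  obtain ⟨d, hd⟩ := Nat.exists_eq_add_of_le hmi
  have : (-1 : ℝ) ^ (n i - m i) = (-1) ^ n i * (-1) ^ m i := by
    rw [hd, Nat.add_sub_cancel_left, pow_add, mul_right_comm, ← mul_pow]
    simp
  rw [this]
  ring
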